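/- Let X be a nonempty complete metric space equipped with a geodesic structure σ that is Busemann convex and geodesically complete with respect to σ, and let m be a Borel measure on X that is locally finite, positive on every nonempty open set, and satisfies MCP(0,N) with respect to σ for some real N ≥ 1. Then for all x, y ∈ X and all r > 0, m (ball x r) = m (ball y r). -/

import Mathlib

open Metric MeasureTheory ENNReal Filter

/-- A geodesic structure on a metric space. -/
structure GeodesicStructure (X : Type*) [MetricSpace X] where
  σ : X → X → ℝ → X
  σ_zero : ∀ x y, σ x y 0 = x
  σ_one : ∀ x y, σ x y 1 = y
  dist_σ : ∀ x y, ∀ s ∈ Set.Icc (0:ℝ) 1, ∀ t ∈ Set.Icc (0:ℝ) 1,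
    dist (σ x y s) (σ x y t) = |s - t| * dist x y
  σ_comp : ∀ x y, ∀ s ∈ Set.Icc (0:ℝ) 1, ∀ t ∈ Set.Icc (0:ℝ) 1,
    σ x (σ x y t) s = σ x y (s * t)

/-- Busemann convexity of a geodesic structure. -/
def GeodesicStructure.BusemannConvex {X : Type*} [MetricSpace X]
    (G : GeodesicStructure X) : Prop :=
  ∀ p x y : X, ∀ t ∈ Set.Icc (0:ℝ) 1, dist (G.σ p x t) (G.σ p y t) ≤ t * dist x y

/-- Geodesic completeness with respect to a geodesic structure. -/
def GeodesicStructure.GeodComplete {X : Type*} [MetricSpace X]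
    (G : GeodesicStructure X) : Prop :=
  ∀ x y : X, x ≠ y → ∀ R : ℝ, dist x y ≤ R →
    ∃ z : X, dist x z = R ∧ G.σ x z (dist x y / R) = y

/-- The measure contraction property MCP(0,N) with respect to a geodesic structure. -/
def GeodesicStructure.MCPzero {X : Type*} [MetricSpace X] [MeasurableSpace X]
    (G : GeodesicStructure X) (m : Measure X) (N : ℝ) : Prop :=
  ∀ p : X, ∀ A : Set X, MeasurableSet A → ∀ t ∈ Set.Icc (0:ℝ) 1,
    ENNReal.ofReal (t ^ N) * m A ≤ m ((fun x => G.σ p x t) '' A)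

namespace GeodesicStructure

variable {X : Type*} [MetricSpace X] {G : GeodesicStructure X}

theorem σ_self (G : GeodesicStructure X) (p : X) {t : ℝ} (ht : t ∈ Set.Icc (0:ℝ) 1) :
    G.σ p p t = p := by
  have h := G.dist_σ p p 0 ⟨le_rfl, zero_le_one⟩ t ht
  rw [dist_self, mul_zero, G.σ_zero] at h
  exact (dist_eq_zero.1 h).symm

theorem dist_left_σ (G : GeodesicStructure X) (p x : X) {t : ℝ} (ht : t ∈ Set.Icc (0:ℝ) 1) :
    dist p (G.σ p x t) = t * dist p x := by
  have h := G.dist_σ p x 0 ⟨le_rfl, zero_le_one⟩ t ht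
  rwa [G.σ_zero, zero_sub, abs_neg, abs_of_nonneg ht.1] at h

theorem dist_σ_right (G : GeodesicStructure X) (p x : X) {t : ℝ} (ht : t ∈ Set.Icc (0:ℝ) 1) :
    dist (G.σ p x t) x = (1 - t) * dist p x := by
  have h := G.dist_σ p x t ht 1 ⟨zero_le_one, le_rfl⟩
  rwa [G.σ_one, abs_sub_comm, abs_of_nonneg (by linarith [ht.2])] at h

section Measure

variable [MeasurableSpace X] [BorelSpace X] {m : Measure X} {N : ℝ}

theorem MCPzero.rpow_mul_measure_ball_le (hMCP : G.MCPzero m N) (hB : G.BusemannConvex)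
    (p x : X) (r : ℝ) {t : ℝ} (h0 : 0 < t) (h1 : t ≤ 1) :
    ENNReal.ofReal (t ^ N) * m (ball x r) ≤ m (ball (G.σ p x t) (t * r)) := by
  refine (hMCP p _ measurableSet_ball t ⟨h0.le, h1⟩).trans (measure_mono ?_)
  rintro _ ⟨w, hw, rfl⟩
  exact (hB p w x t ⟨h0.le, h1⟩).trans_lt (mul_lt_mul_of_pos_left hw h0)

theorem MCPzero.measure_ball_ne_top [IsLocallyFiniteMeasure m] (hMCP : G.MCPzero m N)
    (hB : G.BusemannConvex) (p : X) (r : ℝ) : m (ball p r) ≠ ∞ := by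
  obtain ⟨s, hs, hfin⟩ := m.finiteAt_nhds p
  obtain ⟨ε, hε, hεs⟩ := Metric.mem_nhds_iff.1 hs
  rcases le_or_gt r ε with hr | hr
  · exact (measure_mono ((ball_subset_ball hr).trans hεs)).trans_lt hfin |>.ne
  have hr0 : 0 < r := hε.trans hr
  have ht : 0 < ε / r := div_pos hε hr0
  have ht1 : ε / r ≤ 1 := (div_le_one hr0).2 hr.le
  have h := hMCP.rpow_mul_measure_ball_le hB p p r ht ht1
  rw [G.σ_self p ⟨ht.le, ht1⟩, div_mul_cancel₀ _ hr0.ne'] at h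
  intro htop
  rw [htop, ENNReal.mul_top (by simpa using Real.rpow_pos_of_pos ht N)] at h
  exact absurd (h.trans (measure_mono hεs)) (not_le.2 hfin)

theorem MCPzero.rpow_mul_real_ball_le [IsLocallyFiniteMeasure m] (hMCP : G.MCPzero m N)
    (hB : G.BusemannConvex) (p x : X) (r : ℝ) {t : ℝ} (h0 : 0 < t) (h1 : t ≤ 1) :
    t ^ N * m.real (ball x r) ≤ m.real (ball (G.σ p x t) (t * r)) := by
  have h := ENNReal.toReal_mono (hMCP.measure_ball_ne_top hB _ _)
    (hMCP.rpow_mul_measure_ball_le hB p x r h0 h1)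
  rwa [ENNReal.toReal_mul, ENNReal.toReal_ofReal (Real.rpow_nonneg h0.le N)] at h

theorem MCPzero.real_ball_pos [IsLocallyFiniteMeasure m] [m.IsOpenPosMeasure]
    (hMCP : G.MCPzero m N) (hB : G.BusemannConvex) (p : X) {r : ℝ} (hr : 0 < r) :
    0 < m.real (ball p r) :=
  ENNReal.toReal_pos (measure_ball_pos m p hr).ne' (hMCP.measure_ball_ne_top hB p r)

/-- Bishop–Gromov comparison of concentric balls. -/
theorem MCPzero.bishop_gromov [IsLocallyFiniteMeasure m] (hMCP : G.MCPzero m N)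
    (hB : G.BusemannConvex) (p : X) {r R : ℝ} (hr : 0 < r) (hrR : r ≤ R) :
    (r / R) ^ N * m.real (ball p R) ≤ m.real (ball p r) := by
  have hR : 0 < R := hr.trans_le hrR
  have ht : 0 < r / R := div_pos hr hR
  have ht1 : r / R ≤ 1 := (div_le_one hR).2 hrR
  have h := hMCP.rpow_mul_real_ball_le hB p p R ht ht1
  rwa [G.σ_self p ⟨ht.le, ht1⟩, div_mul_cancel₀ _ hR.ne'] at h

theorem MCPzero.log_real_ball_sub_le [IsLocallyFiniteMeasure m] [m.IsOpenPosMeasure]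
    (hMCP : G.MCPzero m N) (hB : G.BusemannConvex) (hN : 0 ≤ N) {r : ℝ} (hr : 0 < r) (x y : X) :
    Real.log (m.real (ball x r)) ≤ Real.log (m.real (ball y r)) + N / r * dist x y := by
  set d := dist x y
  have hd0 : 0 ≤ d := dist_nonneg
  have hrd : 0 < r + d := by linarith
  have hsub : m.real (ball x r) ≤ m.real (ball y (r + d)) :=
    measureReal_mono (ball_subset_ball' le_rfl) (hMCP.measure_ball_ne_top hB _ _)
  have hBG := hMCP.bishop_gromov hB y hr (by linarith : r ≤ r + d)
  have hq : 0 < r / (r + d) := div_pos hr hrd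
  have hx := hMCP.real_ball_pos hB x hr
  have h := Real.log_le_log (mul_pos (Real.rpow_pos_of_pos hq N) hx)
    ((mul_le_mul_of_nonneg_left hsub (Real.rpow_nonneg hq.le N)).trans hBG)
  rw [Real.log_mul (Real.rpow_pos_of_pos hq N).ne' hx.ne', Real.log_rpow hq] at h
  have hlog : -(d / r) ≤ Real.log (r / (r + d)) := by
    have := Real.one_sub_inv_le_log_of_pos hq
    rw [inv_div, add_div, div_self hr.ne'] at this
    linarith
  have := mul_le_mul_of_nonneg_left hlog hN
  have e : N / r * d = N * (d / r) := by ring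
  linarith

/-- No bounded sequence is uniformly separated. -/
theorem MCPzero.exists_lt_dist_lt [IsLocallyFiniteMeasure m] [m.IsOpenPosMeasure]
    (hMCP : G.MCPzero m N) (hB : G.BusemannConvex) (p : X) {ρ ε : ℝ} (hρ : 0 < ρ) (hε : 0 < ε)
    (u : ℕ → X) (hu : ∀ n, dist (u n) p ≤ ρ) : ∃ i j, i < j ∧ dist (u i) (u j) < ε := by
  by_contra! hsep
  have hdisj : Pairwise (Function.onFun Disjoint fun n => ball (u n) (ε / 2)) := by
    intro i j hij
    refine ball_disjoint_ball ?_
    rcases hij.lt_or_gt with h | h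
    · linarith [hsep i j h]
    · linarith [hsep j i h, dist_comm (u i) (u j)]
  have hUnion : m (⋃ n, ball (u n) (ε / 2)) ≠ ∞ := by
    refine ((measure_mono (Set.iUnion_subset fun n => ?_)).trans_lt
      (hMCP.measure_ball_ne_top hB p (ρ + ε)).lt_top).ne
    exact ball_subset_ball' (by linarith [hu n])
  set c := (ε / 2 / (2 * ρ + ε)) ^ N * m.real (ball p ρ)
  have hc0 : 0 < c := mul_pos (Real.rpow_pos_of_pos (by positivity) N) (hMCP.real_ball_pos hB p hρ)
  have hle : ∀ n, ENNReal.ofReal c ≤ m (ball (u n) (ε / 2)) := by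
    intro n
    refine ENNReal.ofReal_le_of_le_toReal (le_trans ?_
      (hMCP.bishop_gromov hB (u n) (half_pos hε) (by linarith : ε / 2 ≤ 2 * ρ + ε)))
    refine mul_le_mul_of_nonneg_left (measureReal_mono (ball_subset_ball' ?_)
      (hMCP.measure_ball_ne_top hB _ _)) (Real.rpow_nonneg (by positivity) N)
    linarith [hu n, dist_comm p (u n)]
  have hfin := Measure.finite_const_le_meas_of_disjoint_iUnion m (ENNReal.ofReal_pos.2 hc0)
    (fun n => measurableSet_ball) hdisj hUnion
  rw [Set.eq_univ_of_forall (s := {n | ENNReal.ofReal c ≤ m (ball (u n) (ε / 2))}) hle] at hfin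
  exact Set.infinite_univ hfin

theorem MCPzero.isCompact_closedBall [CompleteSpace X] [IsLocallyFiniteMeasure m]
    [m.IsOpenPosMeasure] (hMCP : G.MCPzero m N) (hB : G.BusemannConvex) (p : X) {ρ : ℝ}
    (hρ : 0 < ρ) : IsCompact (closedBall p ρ) := by
  refine TotallyBounded.isCompact_of_isClosed (Metric.totallyBounded_iff.2 fun ε hε => ?_)
    isClosed_closedBall
  by_contra! h
  obtain ⟨u, hu, hsep⟩ := exists_seq_of_forall_finset_exists (fun x => x ∈ closedBall p ρ)
    (fun x y => ε ≤ dist x y) (fun s _ => by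
      obtain ⟨y, hy, hys⟩ := Set.not_subset.1 (h s s.finite_toSet)
      refine ⟨y, hy, fun x hx => ?_⟩
      by_contra! hlt
      exact hys (Set.mem_iUnion₂.2 ⟨x, hx, by rwa [mem_ball, dist_comm]⟩))
  obtain ⟨i, j, hij, hd⟩ := hMCP.exists_lt_dist_lt hB p hρ hε u hu
  exact absurd (hsep i j hij) (not_le.2 hd)

/-- First variation: moving `k` towards a far point `z` on an extension of the geodesic from `k`
through `q` decreases, for suitable small displacements `δ`, the distance to `q` by at least
`3 / 4 * δ`. The geodesics from `z` to `k` and from `k` to `z` need not have the same image. -/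
theorem MCPzero.exists_dist_le_sub [IsLocallyFiniteMeasure m] [m.IsOpenPosMeasure]
    (hMCP : G.MCPzero m N) (hB : G.BusemannConvex) (hGC : G.GeodComplete) {k q : X} (hkq : k ≠ q)
    {R : ℝ} (hR : dist k q ≤ R) :
    ∃ z δ, 0 < δ ∧ δ ≤ R / 2 ∧
      dist (G.σ z k (1 - δ / R)) q ≤ dist k q - 3 / 4 * δ := by
  set ρ := dist k q
  have hρ : 0 < ρ := dist_pos.2 hkq
  have hR0 : 0 < R := hρ.trans_le hR
  obtain ⟨z, hz, hzq⟩ := hGC k q hkq R hR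
  set a := ρ / R
  have ha0 : 0 < a := div_pos hρ hR0
  have ha1 : a ≤ 1 := (div_le_one hR0).2 hR
  set δ : ℕ → ℝ := fun n => min 1 (R / 2) * a ^ n with hδ
  have hmin : 0 < min 1 (R / 2) := lt_min one_pos (by linarith)
  have hδ0 : ∀ n, 0 < δ n := fun n => mul_pos hmin (pow_pos ha0 n)
  have hδmin : ∀ n, δ n ≤ min 1 (R / 2) := fun n =>
    mul_le_of_le_one_right hmin.le (pow_le_one₀ ha0.le ha1)
  have hδ1 : ∀ n, δ n ≤ 1 := fun n => (hδmin n).trans (min_le_left _ _)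
  have hδR : ∀ n, δ n ≤ R / 2 := fun n => (hδmin n).trans (min_le_right _ _)
  have hδlt : ∀ i j, i < j → δ j ≤ a * δ i := by
    intro i j hij
    have : a ^ j ≤ a ^ (i + 1) := pow_le_pow_of_le_one ha0.le ha1 hij
    calc δ j ≤ min 1 (R / 2) * a ^ (i + 1) := mul_le_mul_of_nonneg_left this hmin.le
      _ = a * δ i := by simp only [hδ]; ring
  set e : ℕ → X := fun n => G.σ z k (1 - δ n / R)
  have hmem : ∀ n, 1 - δ n / R ∈ Set.Icc (0:ℝ) 1 := by
    intro n
    have h1 : δ n / R ≤ 1 := (div_le_one hR0).2 (by linarith [hδR n])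
    have h2 : 0 < δ n / R := div_pos (hδ0 n) hR0
    exact ⟨by linarith, by linarith⟩
  have hke : ∀ n, dist k (e n) = δ n := by
    intro n
    rw [dist_comm, G.dist_σ_right z k (hmem n), dist_comm z k, hz]
    field_simp
    ring
  have hez : ∀ n, dist (e n) z = R - δ n := by
    intro n
    rw [dist_comm, G.dist_left_σ z k (hmem n), dist_comm z k, hz]
    field_simp
  have hext : ∀ n, ∃ w, dist k w = 1 ∧ G.σ k w (δ n) = e n := by
    intro n
    obtain ⟨w, hw, hwe⟩ := hGC k (e n) (dist_pos.1 (by rw [hke]; exact hδ0 n)) 1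
      (by rw [hke]; exact hδ1 n)
    rw [hke, div_one] at hwe
    exact ⟨w, hw, hwe⟩
  choose w hw hwe using hext
  obtain ⟨i, j, hij, hd⟩ := hMCP.exists_lt_dist_lt hB k one_pos (by norm_num : (0:ℝ) < 1 / 4) w
    (fun n => by rw [dist_comm, hw])
  refine ⟨z, δ j, hδ0 j, hδR j, ?_⟩
  set s := δ j / δ i
  have hsi : s * δ i = δ j := div_mul_cancel₀ _ (hδ0 i).ne'
  have hsa : s ≤ a := (div_le_iff₀ (hδ0 i)).2 (hδlt i j hij)
  have hs0 : 0 < s := div_pos (hδ0 j) (hδ0 i)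
  have hsm : s ∈ Set.Icc (0:ℝ) 1 := ⟨hs0.le, hsa.trans ha1⟩
  have h1 : dist (e j) (G.σ k (e i) s) ≤ δ j * (1 / 4) := by
    rw [← hwe i, G.σ_comp k (w i) s hsm (δ i) ⟨(hδ0 i).le, hδ1 i⟩, hsi, ← hwe j]
    refine (hB k (w j) (w i) (δ j) ⟨(hδ0 j).le, hδ1 j⟩).trans ?_
    exact mul_le_mul_of_nonneg_left (by rw [dist_comm]; exact hd.le) (hδ0 j).le
  have h2 : dist (G.σ k (e i) s) (G.σ k z s) ≤ s * R - δ j := by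
    refine (hB k (e i) z s hsm).trans_eq ?_
    rw [hez, mul_sub, hsi]
  have h3 : dist (G.σ k z s) q = ρ - s * R := by
    have haR : a * R = ρ := div_mul_cancel₀ _ hR0.ne'
    have h := G.dist_σ k z s hsm a ⟨ha0.le, ha1⟩
    rw [hzq, hz, abs_sub_comm, abs_of_nonneg (by linarith), sub_mul, haR] at h
    exact h
  have := dist_triangle4 (e j) (G.σ k (e i) s) (G.σ k z s) q
  linarith

theorem MCPzero.log_real_ball_le_add [CompleteSpace X] [IsLocallyFiniteMeasure m]
    [m.IsOpenPosMeasure] (hMCP : G.MCPzero m N) (hB : G.BusemannConvex) (hGC : G.GeodComplete)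
    (hN : 0 ≤ N) {r : ℝ} (hr : 0 < r) {x q : X} (hxq : x ≠ q) {L : ℝ} (hL : 0 < L) :
    Real.log (m.real (ball x r)) ≤ Real.log (m.real (ball q r)) + L * dist x q := by
  set f : X → ℝ := fun w => Real.log (m.real (ball w r))
  have hfcont : Continuous f := by
    refine (LipschitzWith.of_le_add_mul (N / r).toNNReal fun a b => ?_).continuous
    rw [Real.coe_toNNReal _ (by positivity)]
    exact hMCP.log_real_ball_sub_le hB hN hr a b
  have hxq0 : 0 < dist x q := dist_pos.2 hxq
  obtain ⟨k, hk, hmax⟩ := (hMCP.isCompact_closedBall hB q hxq0).exists_isMaxOn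
    ⟨x, mem_closedBall.2 le_rfl⟩
    (hfcont.sub (continuous_const.mul (continuous_id.dist continuous_const)) :
      Continuous fun w => f w - L * dist w q).continuousOn
  have hkx : f x - L * dist x q ≤ f k - L * dist k q := hmax (mem_closedBall.2 le_rfl)
  rcases eq_or_ne k q with rfl | hkq
  · rw [dist_self] at hkx
    linarith
  exfalso
  set R := dist k q + 4 * N / L with hR
  have hRk : dist k q ≤ R := le_add_of_nonneg_right (by positivity)
  have hR0 : 0 < R := (dist_pos.2 hkq).trans_le hRk
  obtain ⟨z, δ, hδ, hδR, hd⟩ := hMCP.exists_dist_le_sub hB hGC hkq hRk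
  set e := G.σ z k (1 - δ / R)
  have hb : δ / R ≤ 1 / 2 := by rw [div_le_iff₀ hR0]; linarith
  have hb0 : 0 < δ / R := div_pos hδ hR0
  have ht : 0 < 1 - δ / R := by linarith
  have hfe : N * Real.log (1 - δ / R) + f k ≤ f e := by
    have hkpos := hMCP.real_ball_pos hB k hr
    have hmono : m.real (ball e ((1 - δ / R) * r)) ≤ m.real (ball e r) :=
      measureReal_mono (ball_subset_ball (mul_le_of_le_one_left hr.le (by linarith)))
        (hMCP.measure_ball_ne_top hB _ _)
    have h := Real.log_le_log (mul_pos (Real.rpow_pos_of_pos ht N) hkpos)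
      ((hMCP.rpow_mul_real_ball_le hB z k r ht (by linarith)).trans hmono)
    rwa [Real.log_mul (Real.rpow_pos_of_pos ht N).ne' hkpos.ne', Real.log_rpow ht] at h
  have hlog : -(2 * (δ / R)) ≤ Real.log (1 - δ / R) := by
    refine le_trans ?_ (Real.one_sub_inv_le_log_of_pos ht)
    have : (1 - δ / R)⁻¹ ≤ 1 + 2 * (δ / R) := by
      rw [inv_le_iff_one_le_mul₀ ht]
      nlinarith
    linarith
  have hcost : N * (2 * (δ / R)) ≤ L / 2 * δ := by
    have hLR : 4 * N ≤ L * R := by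
      have : L * R = L * dist k q + 4 * N := by rw [hR]; field_simp
      nlinarith [dist_pos.2 hkq]
    have : N * (2 * (δ / R)) = 4 * N * (δ / R) / 2 := by ring
    have h2 : L * R * (δ / R) = L * δ := by field_simp
    nlinarith
  have hemax : f e - L * dist e q ≤ f k - L * dist k q :=
    hmax (mem_closedBall.2 (by linarith [mem_closedBall.1 hk]))
  have := mul_le_mul_of_nonneg_left hlog hN
  have := mul_le_mul_of_nonneg_left hd hL.le
  have := mul_pos hL hδ
  linarith

theorem MCPzero.real_ball_le [CompleteSpace X] [IsLocallyFiniteMeasure m]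
    [m.IsOpenPosMeasure] (hMCP : G.MCPzero m N) (hB : G.BusemannConvex) (hGC : G.GeodComplete)
    (hN : 0 ≤ N) {r : ℝ} (hr : 0 < r) (x y : X) :
    m.real (ball x r) ≤ m.real (ball y r) := by
  rcases eq_or_ne x y with rfl | hxy
  · exact le_rfl
  refine (Real.log_le_log_iff (hMCP.real_ball_pos hB x hr) (hMCP.real_ball_pos hB y hr)).1 ?_
  have hd : 0 < dist x y := dist_pos.2 hxy
  refine le_of_forall_pos_le_add fun ε hε => ?_
  have h := hMCP.log_real_ball_le_add hB hGC hN hr hxy (div_pos hε hd)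
  rwa [div_mul_cancel₀ _ hd.ne'] at h

end Measure

end GeodesicStructure

theorem busemann_mcp_ball_measure_homogeneous
    (X : Type*) [MetricSpace X] [Nonempty X] [CompleteSpace X]
    [MeasurableSpace X] [BorelSpace X]
    (G : GeodesicStructure X) (hB : G.BusemannConvex) (hGC : G.GeodComplete)
    (m : Measure X) (hlf : IsLocallyFiniteMeasure m) (hpos : m.IsOpenPosMeasure)
    (N : ℝ) (hN : 1 ≤ N) (hMCP : G.MCPzero m N) :
    ∀ x y : X, ∀ r : ℝ, 0 < r → m (ball x r) = m (ball y r) := by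
  intro x y r hr
  have hN0 : 0 ≤ N := zero_le_one.trans hN
  refine (ENNReal.toReal_eq_toReal_iff' (hMCP.measure_ball_ne_top hB x r)
    (hMCP.measure_ball_ne_top hB y r)).1 ?_
  exact le_antisymm (hMCP.real_ball_le hB hGC hN0 hr x y) (hMCP.real_ball_le hB hGC hN0 hr y x)
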